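/- Fix λ>0, γ∈ℝ, μ>0 and set ν=λ²cos²γ+λ⁻²sin²γ. Define for t>0 the gaussian kernel G_t(x,y) = (λ·√(2π·ν·sinh(tμ)))⁻¹ · exp( −[ (x−y)²/tanh(tμ) + (x+y)²·tanh(tμ) ] / (4ν) ) (the modulus of the Mehler kernel of a symmetry-invariant harmonic oscillator). Let θ>0 be such that θ/(2π) is of Roth type. Then for every ε>0 there exist C>0 and t₀>0 such that for all 0<t<t₀: sup over 0≤x≤2π·θ^{−1/2} and 0≤y≤θ^{1/2} of Σ_{m∈ℤ²} G_t( x+2π·m₁·θ^{−1/2}, y+θ^{1/2}·m₂ ) ≤ C·t^{−1/2−ε}. -/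

import Mathlib

open Real

/-- A real number `α` is of Roth type if for every `ε > 0` there is `c > 0` such that
`|α − p/q| ≥ c · q^{−(2+ε)}` for every rational `p/q` with `q ≥ 1`. -/
def IsRothType (α : ℝ) : Prop :=
  ∀ ε > (0 : ℝ), ∃ c > (0 : ℝ), ∀ (p : ℤ) (q : ℕ), 1 ≤ q →
    c / (q : ℝ) ^ ((2 : ℝ) + ε) ≤ |α - (p : ℝ) / (q : ℝ)|

/-- The modulus of the Mehler kernel of a symmetry-invariant harmonic oscillator:
`G_t(x,y) = (λ √(2πν sinh(tμ)))⁻¹ exp(−[(x−y)²/tanh(tμ) + (x+y)² tanh(tμ)]/(4ν))`. -/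
noncomputable def mehlerGauss (lam ν μ t x y : ℝ) : ℝ :=
  (lam * Real.sqrt (2 * π * ν * Real.sinh (t * μ)))⁻¹ *
    Real.exp (-(((x - y) ^ 2 / Real.tanh (t * μ) + (x + y) ^ 2 * Real.tanh (t * μ)) / (4 * ν)))

theorem IsRothType.exists_le_abs_sub_mul {α : ℝ} (h : IsRothType α) {δ : ℝ} (hδ : 0 < δ) :
    ∃ c > (0 : ℝ), ∀ p q : ℤ, q ≠ 0 → c / |(q : ℝ)| ^ (1 + δ) ≤ |p - α * q| := by
  obtain ⟨c, hc, H⟩ := h δ hδ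
  refine ⟨c, hc, fun p q hq => ?_⟩
  have hQ : (0 : ℝ) < |(q : ℝ)| := abs_pos.mpr (by exact_mod_cast hq)
  have key : ∃ p' : ℤ, |(p : ℝ) - α * q| = |(q : ℝ)| * |(α - p' / (|(q : ℝ)|))| := by
    rcases lt_or_gt_of_ne hq with h0 | h0
    · have h1 : (q : ℝ) < 0 := by exact_mod_cast h0
      refine ⟨-p, ?_⟩
      rw [← abs_of_pos hQ, ← abs_mul, abs_abs, abs_of_neg h1]
      congr 1
      push_cast
      field_simp
      ring
    · have h1 : (0 : ℝ) < q := by exact_mod_cast h0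
      refine ⟨p, ?_⟩
      rw [abs_of_pos h1, ← abs_neg, ← abs_of_pos h1, ← abs_mul, abs_of_pos h1]
      congr 1
      field_simp
      ring
  obtain ⟨p', hp'⟩ := key
  have h2 := H p' q.natAbs (Nat.one_le_iff_ne_zero.mpr (Int.natAbs_ne_zero.mpr hq))
  have h3 : ((q.natAbs : ℕ) : ℝ) = |(q : ℝ)| := by
    rw [Nat.cast_natAbs, Int.cast_abs]
  rw [h3] at h2
  rw [hp']
  calc c / |(q : ℝ)| ^ (1 + δ) = |(q : ℝ)| * (c / |(q : ℝ)| ^ (2 + δ)) := by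
        rw [show 2 + δ = 1 + (1 + δ) by ring, Real.rpow_add hQ 1 (1 + δ), Real.rpow_one]
        field_simp
    _ ≤ _ := by gcongr

theorem summable_exp_neg_mul_abs_int {s : ℝ} (hs : 0 < s) :
    Summable fun i : ℤ => Real.exp (-(s * |(i : ℝ)|)) := by
  have h : Summable fun n : ℕ => Real.exp (-(s * (n : ℝ))) := by
    have := Real.summable_exp_nat_mul_iff.mpr (neg_lt_zero.mpr hs)
    refine this.congr fun n => ?_
    congr 1
    ring
  refine Summable.of_nat_of_neg ?_ ?_ <;> simpa using h

theorem tsum_exp_neg_mul_abs_int_le {s : ℝ} (hs : 0 < s) :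
    ∑' i : ℤ, Real.exp (-(s * |(i : ℝ)|)) ≤ 2 * (1 + s) / s := by
  have hlt : Real.exp (-s) < 1 := by simpa using hs
  have h : HasSum (fun n : ℕ => Real.exp (-(s * (n : ℝ)))) (1 - Real.exp (-s))⁻¹ := by
    refine (hasSum_geometric_of_lt_one (Real.exp_pos _).le hlt).congr_fun fun n => ?_
    rw [← Real.exp_nat_mul]
    congr 1
    ring
  have h' := HasSum.of_nat_of_neg (f := fun i : ℤ => Real.exp (-(s * |(i : ℝ)|)))
    (by simpa using h) (by simpa using h)
  rw [h'.tsum_eq]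
  have hb : (1 - Real.exp (-s))⁻¹ ≤ (1 + s) / s := by
    rw [inv_le_comm₀ (by linarith) (by positivity), inv_div]
    have : Real.exp (-s) ≤ 1 / (1 + s) := by
      rw [Real.exp_neg, ← one_div]
      exact one_div_le_one_div_of_le (by linarith) (by linarith [Real.add_one_le_exp s])
    have h2 : s / (1 + s) = 1 - 1 / (1 + s) := by field_simp; ring
    linarith
  have h0 : Real.exp (-(s * |((0 : ℤ) : ℝ)|)) = 1 := by simp
  rw [h0, mul_div_assoc]
  linarith

theorem exp_neg_mul_sq_le_floor {k r : ℝ} (hk : 0 < k) (hr : 0 < r) (hr1 : r ≤ 1) (u : ℝ) :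
    Real.exp (-(k * u ^ 2)) ≤ Real.exp (2 * k) * Real.exp (-(k * r * |(⌊u / r⌋ : ℝ)|)) := by
  rw [← Real.exp_add, Real.exp_le_exp]
  have h1 : |(⌊u / r⌋ : ℝ)| ≤ |u / r| + 1 := by
    have h2 := Int.floor_le (u / r)
    have h3 := Int.lt_floor_add_one (u / r)
    have h4 : |(⌊u / r⌋ : ℝ) - u / r| ≤ 1 := by rw [abs_le]; constructor <;> linarith
    have := abs_sub_abs_le_abs_sub (⌊u / r⌋ : ℝ) (u / r)
    linarith
  have h5 : r * |(⌊u / r⌋ : ℝ)| ≤ |u| + r := by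
    calc r * |(⌊u / r⌋ : ℝ)| ≤ r * (|u / r| + 1) := by gcongr
      _ = |u| + r := by rw [abs_div, abs_of_pos hr]; field_simp
  have h6 : |u| ≤ u ^ 2 + 1 := by nlinarith [sq_abs u, sq_nonneg (|u| - 1), abs_nonneg u]
  nlinarith

theorem exists_lattice_gaussian_sum_le {a b : ℝ} (ha : 0 < a) (hb : 0 < b)
    (h : IsRothType (b / a)) {k δ : ℝ} (hk : 0 < k) (hδ : 0 < δ) :
    ∃ C > (0 : ℝ), ∀ w : ℝ, 0 < w → w ≤ 1 → ∀ s r : ℝ,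
      ∑' m : ℤ × ℤ, Real.exp (-(k * ((s + (a * m.1 - b * m.2)) / w) ^ 2 +
        k * ((r + (a * m.1 + b * m.2)) * w) ^ 2)) ≤ C * w ^ (-δ) := by
  obtain ⟨c, hc, hgap⟩ := h.exists_le_abs_sub_mul hδ
  obtain ⟨d, hd, hd1, hda, hdc⟩ : ∃ d > 0, d ≤ 1 ∧ d ≤ a ∧ d ≤ a * c * b ^ (1 + δ) :=
    ⟨min 1 (min a (a * c * b ^ (1 + δ))), by positivity, min_le_left _ _,
      (min_le_right _ _).trans (min_le_left _ _), (min_le_right _ _).trans (min_le_right _ _)⟩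
  refine ⟨Real.exp (2 * k) ^ 2 * (2 * (1 + k) / (k * d)) * (2 * (1 + k) / k), by positivity,
    fun w hw hw1 s r => ?_⟩
  set ρ : ℝ := d * w ^ δ with hρ
  have hwδ : 0 < w ^ δ := Real.rpow_pos_of_pos hw δ
  have hρ0 : 0 < ρ := by positivity
  have hρ1 : ρ ≤ 1 := mul_le_one₀ hd1 hwδ.le (Real.rpow_le_one hw.le hw1 hδ.le)
  set A : ℤ × ℤ → ℝ := fun m => s + (a * m.1 - b * m.2) with hA
  set B : ℤ × ℤ → ℝ := fun m => r + (a * m.1 + b * m.2) with hB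
  set φ : ℤ × ℤ → ℤ × ℤ := fun m => (⌊A m / w / ρ⌋, ⌊B m * w / 1⌋) with hφ
  have hinj : Function.Injective φ := by
    intro m m' hmm
    have e1 : ⌊A m / w / ρ⌋ = ⌊A m' / w / ρ⌋ := congrArg Prod.fst hmm
    have e2 : ⌊B m * w / 1⌋ = ⌊B m' * w / 1⌋ := congrArg Prod.snd hmm
    have l1 : |A m - A m'| < w * ρ := by
      have := Int.abs_sub_lt_one_of_floor_eq_floor e1
      rw [← sub_div, ← sub_div, div_div, abs_div, abs_of_pos (by positivity : 0 < w * ρ),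
        div_lt_one (by positivity)] at this
      exact this
    have l2 : |B m - B m'| * w < 1 := by
      have := Int.abs_sub_lt_one_of_floor_eq_floor e2
      rwa [← sub_div, ← sub_mul, div_one, abs_mul, abs_of_pos hw] at this
    obtain ⟨p, q, hp, hq⟩ : ∃ p q : ℤ, p = m.1 - m'.1 ∧ q = m.2 - m'.2 := ⟨_, _, rfl, rfl⟩
    have hAp : A m - A m' = a * p - b * q := by simp only [hA, hp, hq]; push_cast; ring
    have hBp : B m - B m' = a * p + b * q := by simp only [hB, hp, hq]; push_cast; ring
    rw [hAp] at l1
    rw [hBp] at l2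
    have hwρ : w * ρ ≤ d := by
      rw [hρ]
      have : w * w ^ δ ≤ 1 := mul_le_one₀ hw1 hwδ.le (Real.rpow_le_one hw.le hw1 hδ.le)
      nlinarith
    have hq0 : q = 0 := by
      by_contra hne
      have hQ : (0 : ℝ) < |(q : ℝ)| := abs_pos.mpr (by exact_mod_cast hne)
      have h1 : |(q : ℝ)| * (b * w) ≤ 1 := by
        have t1 : 2 * (b * |(q : ℝ)|) ≤ |a * p + b * q| + |a * p - b * q| := by
          calc 2 * (b * |(q : ℝ)|) = |(a * p + b * q) - (a * p - b * q)| := by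
                rw [show (a * p + b * q) - (a * p - b * q) = 2 * b * q by ring, abs_mul,
                  abs_of_pos (by positivity : 0 < 2 * b)]
                ring
            _ ≤ _ := abs_sub _ _
        have t2 : |a * p - b * q| * w ≤ 1 := by
          have : |a * p - b * q| ≤ 1 := by linarith
          exact mul_le_one₀ this hw.le hw1
        nlinarith
      have h2 : |(q : ℝ)| ^ (1 + δ) * (b ^ (1 + δ) * w ^ (1 + δ)) ≤ 1 := by
        rw [← Real.mul_rpow hb.le hw.le, ← Real.mul_rpow hQ.le (by positivity)]
        exact Real.rpow_le_one (by positivity) h1 (by positivity)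
      have h3 : |a * p - b * q| = a * |p - b / a * q| := by
        rw [← abs_of_pos ha, ← abs_mul, abs_of_pos ha]
        congr 1
        field_simp
      have h4 := hgap p q hne
      have hQp : 0 < |(q : ℝ)| ^ (1 + δ) := Real.rpow_pos_of_pos hQ _
      have h5 : w * ρ ≤ a * (c / |(q : ℝ)| ^ (1 + δ)) := by
        rw [← mul_div_assoc, le_div_iff₀ hQp]
        calc w * ρ * |(q : ℝ)| ^ (1 + δ) = d * (|(q : ℝ)| ^ (1 + δ) * w ^ (1 + δ)) := by
              rw [hρ, Real.rpow_add hw, Real.rpow_one]; ring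
          _ ≤ a * c * b ^ (1 + δ) * (|(q : ℝ)| ^ (1 + δ) * w ^ (1 + δ)) := by gcongr
          _ = a * c * (|(q : ℝ)| ^ (1 + δ) * (b ^ (1 + δ) * w ^ (1 + δ))) := by ring
          _ ≤ a * c * 1 := by gcongr
          _ = a * c := mul_one _
      have h6 : a * (c / |(q : ℝ)| ^ (1 + δ)) ≤ a * |p - b / a * q| := by gcongr
      linarith
    have hp0 : p = 0 := by
      by_contra hne
      have h1 : (1 : ℝ) ≤ |(p : ℝ)| := by exact_mod_cast Int.one_le_abs hne
      rw [hq0, Int.cast_zero, mul_zero, sub_zero, abs_mul, abs_of_pos ha] at l1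
      nlinarith
    exact Prod.ext (by omega) (by omega)
  set E : ℝ := Real.exp (2 * k) with hE
  set F : ℤ × ℤ → ℝ := fun i =>
    (E * Real.exp (-(k * ρ * |(i.1 : ℝ)|))) * (E * Real.exp (-(k * 1 * |(i.2 : ℝ)|))) with hF
  have s1 := (summable_exp_neg_mul_abs_int (mul_pos hk hρ0)).mul_left E
  have s2 := (summable_exp_neg_mul_abs_int (mul_pos hk one_pos)).mul_left E
  have hFs : Summable F := s1.mul_of_nonneg s2 (fun _ => by positivity) (fun _ => by positivity)
  have hFφ : Summable (F ∘ φ) := hFs.comp_injective hinj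
  have hle : ∀ m : ℤ × ℤ, Real.exp (-(k * (A m / w) ^ 2 + k * (B m * w) ^ 2)) ≤ F (φ m) := by
    intro m
    rw [neg_add, Real.exp_add]
    exact mul_le_mul (exp_neg_mul_sq_le_floor hk hρ0 hρ1 _)
      (exp_neg_mul_sq_le_floor hk one_pos le_rfl _) (by positivity) (by positivity)
  have hsum : Summable fun m => Real.exp (-(k * (A m / w) ^ 2 + k * (B m * w) ^ 2)) :=
    Summable.of_nonneg_of_le (fun _ => by positivity) hle hFφ
  calc ∑' m, Real.exp (-(k * (A m / w) ^ 2 + k * (B m * w) ^ 2))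
      ≤ ∑' m, F (φ m) := hsum.tsum_le_tsum hle hFφ
    _ ≤ ∑' i, F i := tsum_comp_le_tsum_of_inj hFs (fun _ => by positivity) hinj
    _ = (E * ∑' i : ℤ, Real.exp (-(k * ρ * |(i : ℝ)|))) *
          (E * ∑' i : ℤ, Real.exp (-(k * 1 * |(i : ℝ)|))) := by
        rw [← tsum_mul_left, ← tsum_mul_left, s1.tsum_mul_tsum s2 hFs]
    _ ≤ (E * (2 * (1 + k * ρ) / (k * ρ))) * (E * (2 * (1 + k * 1) / (k * 1))) := by
        have i1 := tsum_exp_neg_mul_abs_int_le (mul_pos hk hρ0)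
        have i2 := tsum_exp_neg_mul_abs_int_le (mul_pos hk one_pos)
        gcongr
    _ ≤ (E * (2 * (1 + k * 1) / (k * ρ))) * (E * (2 * (1 + k * 1) / (k * 1))) := by
        gcongr
    _ = _ := by
        rw [hρ, Real.rpow_neg hw.le]
        field_simp

theorem half_le_tanh {s : ℝ} (hs : 0 ≤ s) (hs1 : s ≤ 1) : s / 2 ≤ Real.tanh s := by
  have h1 : Real.cosh s ≤ 2 := by
    refine (Real.cosh_le_exp_half_sq s).trans ?_
    have h2 : Real.exp (s ^ 2 / 2) ≤ Real.exp (1 / 2) := Real.exp_le_exp.mpr (by nlinarith)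
    have h3 : Real.exp (1 / 2) ^ 2 = Real.exp 1 := by rw [← Real.exp_nat_mul]; norm_num
    nlinarith [Real.exp_one_lt_d9, Real.exp_pos (1 / 2)]
  rw [Real.tanh_eq_sinh_div_cosh, le_div_iff₀ (Real.cosh_pos s)]
  nlinarith [Real.self_le_sinh_iff.mpr hs]

/-- **Lattice sums of the Mehler kernel (Proposition 6 of Bellissard–Schulz-Baldes).**
Fix `λ > 0`, `γ ∈ ℝ`, `μ > 0`, set `ν = λ² cos²γ + λ⁻² sin²γ`, and let `θ > 0` be such that
`θ/2π` is of Roth type.  Then for every `ε > 0` there exist `C > 0` and `t₀ > 0` such that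
for all `0 < t < t₀`, the supremum over `0 ≤ x ≤ 2πθ^{−1/2}` and `0 ≤ y ≤ θ^{1/2}` of
`Σ_{m∈ℤ²} G_t(x + 2πm₁θ^{−1/2}, y + θ^{1/2}m₂)` is at most `C·t^{−1/2−ε}`. -/
theorem mehler_lattice_sum_bound (lam γ μ : ℝ) (hlam : 0 < lam) (hμ : 0 < μ)
    (ν : ℝ) (hν : ν = lam ^ 2 * Real.cos γ ^ 2 + (lam ^ 2)⁻¹ * Real.sin γ ^ 2)
    (θ : ℝ) (hθ : 0 < θ) (hroth : IsRothType (θ / (2 * π))) :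
    ∀ ε > (0 : ℝ), ∃ C > (0 : ℝ), ∃ t₀ > (0 : ℝ), ∀ t : ℝ, 0 < t → t < t₀ →
      ∀ x y : ℝ, 0 ≤ x → x ≤ 2 * π / Real.sqrt θ → 0 ≤ y → y ≤ Real.sqrt θ →
        (∑' m : ℤ × ℤ, mehlerGauss lam ν μ t
            (x + 2 * π * (m.1 : ℝ) / Real.sqrt θ) (y + Real.sqrt θ * (m.2 : ℝ)))
          ≤ C * t ^ (-(1 / 2 : ℝ) - ε) := by
  intro ε hε
  have hν0 : 0 < ν := by
    have h1 : 0 < lam ^ 2 := by positivity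
    have h2 : 0 < (lam ^ 2)⁻¹ := by positivity
    rw [hν]
    rcases (sq_nonneg (Real.cos γ)).eq_or_lt with h0 | h0
    · have h3 := Real.sin_sq_add_cos_sq γ
      rw [← h0, add_zero] at h3
      rw [← h0, h3]
      linarith
    · have := mul_pos h1 h0
      have := mul_nonneg h2.le (sq_nonneg (Real.sin γ))
      linarith
  have hsθ : 0 < Real.sqrt θ := Real.sqrt_pos.mpr hθ
  have hratio : Real.sqrt θ / (2 * π / Real.sqrt θ) = θ / (2 * π) := by
    rw [div_div_eq_mul_div, Real.mul_self_sqrt hθ.le]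
  obtain ⟨C, hC, H⟩ := exists_lattice_gaussian_sum_le (a := 2 * π / Real.sqrt θ) (b := Real.sqrt θ)
    (by positivity) hsθ (by rwa [hratio]) (k := 1 / (4 * ν)) (δ := 2 * ε) (by positivity)
    (by positivity)
  refine ⟨(lam * Real.sqrt (2 * π * ν * μ))⁻¹ * (C * (μ / 2) ^ (-ε)), by positivity, 1 / μ,
    by positivity, fun t ht ht0 x y _ _ _ _ => ?_⟩
  have htμ : 0 < t * μ := by positivity
  have htμ1 : t * μ ≤ 1 := ((lt_div_iff₀ hμ).mp ht0).le
  have hT := half_le_tanh htμ.le htμ1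
  set T := Real.tanh (t * μ) with hTdef
  have hT0 : 0 < T := by linarith
  have hT1 : T ≤ 1 := (Real.tanh_lt_one _).le
  have hw0 : 0 < Real.sqrt T := Real.sqrt_pos.mpr hT0
  have hwsq : Real.sqrt T ^ 2 = T := Real.sq_sqrt hT0.le
  have hsum := H (Real.sqrt T) hw0 (Real.sqrt_le_one.mpr hT1) (x - y) (x + y)
  have hpow : Real.sqrt T ^ (-(2 * ε)) = T ^ (-ε) := by
    rw [Real.sqrt_eq_rpow, ← Real.rpow_mul hT0.le]
    congr 1
    ring
  have hTpow : T ^ (-ε) ≤ (μ / 2) ^ (-ε) * t ^ (-ε) := by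
    rw [← Real.mul_rpow (by positivity) ht.le]
    exact Real.rpow_le_rpow_of_nonpos (by positivity) (by linarith) (by linarith)
  have hpre : (lam * Real.sqrt (2 * π * ν * Real.sinh (t * μ)))⁻¹ ≤
      (lam * Real.sqrt (2 * π * ν * μ))⁻¹ * t ^ (-(1 / 2 : ℝ)) := by
    rw [Real.rpow_neg ht.le, ← Real.sqrt_eq_rpow, ← mul_inv, mul_assoc lam,
      ← Real.sqrt_mul (by positivity)]
    have h1 : 2 * π * ν * μ * t ≤ 2 * π * ν * Real.sinh (t * μ) := by
      rw [mul_assoc _ μ t, mul_comm μ t]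
      have := Real.self_le_sinh_iff.mpr htμ.le
      gcongr
    gcongr
  have hterm : ∀ m : ℤ × ℤ, mehlerGauss lam ν μ t
      (x + 2 * π * (m.1 : ℝ) / Real.sqrt θ) (y + Real.sqrt θ * (m.2 : ℝ)) =
      (lam * Real.sqrt (2 * π * ν * Real.sinh (t * μ)))⁻¹ *
        Real.exp (-(1 / (4 * ν) *
          ((x - y + (2 * π / Real.sqrt θ * m.1 - Real.sqrt θ * m.2)) / Real.sqrt T) ^ 2 +
          1 / (4 * ν) *
          ((x + y + (2 * π / Real.sqrt θ * m.1 + Real.sqrt θ * m.2)) * Real.sqrt T) ^ 2)) := by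
    intro m
    rw [mehlerGauss, ← hTdef, div_pow, mul_pow, hwsq]
    congr 2
    ring
  simp_rw [hterm]
  rw [tsum_mul_left]
  rw [hpow] at hsum
  calc _ ≤ ((lam * Real.sqrt (2 * π * ν * μ))⁻¹ * t ^ (-(1 / 2 : ℝ))) *
        (C * ((μ / 2) ^ (-ε) * t ^ (-ε))) := by
        refine mul_le_mul hpre (hsum.trans (by gcongr))
          (tsum_nonneg fun _ => (Real.exp_pos _).le) (by positivity)
    _ = _ := by
        rw [sub_eq_add_neg, Real.rpow_add ht]
        ring
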